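/- For every integer c, g(c) := Σ_{d∈(ℤ/p^hℤ)^×} (d/p)^j · λ₁((4−c²)d) equals: p^{h−1}(p−1) if j is even and p^h | 4−c²; −p^{h−1} if j is even and 4−c² = p^{h−1}c₁ with p ∤ c₁; (c₁r/p)·c_p·p^{h−1}·√p if j is odd and 4−c² = p^{h−1}c₁ with p ∤ c₁; and 0 in all other cases. (§4, case (v): evaluation of the twisted sum g(c).) -/

import Mathlib

noncomputable section
open Matrix Complex

/-- The additive character `x ↦ ζ_N^{r·x} = exp(2πi·r·x/N)` of `ZMod N`. -/
def aChar (N : ℕ) (r : ℤ) (x : ZMod N) : ℂ :=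
  Complex.exp (2 * Real.pi * Complex.I * (r : ℂ) * (x.val : ℂ) / (N : ℂ))

/-- The Legendre symbol `(x/p)` of an element `x : ZMod N` (via its residue mod `p`). -/
def legC (p : ℕ) [Fact p.Prime] {N : ℕ} (x : ZMod N) : ℂ :=
  (legendreSym p (x.val : ℤ) : ℂ)

/-- `c_p = (−1/p)^{1/2}`: `1` if `p ≡ 1 (mod 4)` and `√−1` if `p ≡ 3 (mod 4)`. -/
def cP (p : ℕ) : ℂ := if p % 4 = 1 then 1 else Complex.I

open Filter Topology in
lemma tendsto_jacobiTheta₂_one {ι : Type*} {l : Filter ι} (x : ℝ) {τ : ι → ℂ}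
    (hτ : Tendsto (fun t ↦ (τ t).im) l atTop) :
    Tendsto (fun t ↦ jacobiTheta₂ x (τ t)) l (𝓝 1) := by
  have hsum : Summable fun n : ℤ ↦ Real.exp (-Real.pi * (1 * n ^ 2 - 2 * 0 * |n|)) := by
    simpa only [pow_zero, one_mul] using
      summable_pow_mul_jacobiTheta₂_term_bound 0 (zero_lt_one' ℝ) 0
  have key := tendsto_tsum_of_dominated_convergence (𝓕 := l)
    (f := fun t n ↦ jacobiTheta₂_term n x (τ t)) (g := fun n : ℤ ↦ if n = 0 then (1 : ℂ) else 0)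
    hsum ?_ ?_
  · rwa [tsum_ite_eq] at key
  · intro n
    by_cases hn : n = 0
    · simpa [hn, jacobiTheta₂_term] using tendsto_const_nhds
    · simp only [hn, if_false]
      rw [tendsto_zero_iff_norm_tendsto_zero]
      simp only [norm_jacobiTheta₂_term, ofReal_im, mul_zero, sub_zero]
      refine Real.tendsto_exp_atBot.comp (hτ.const_mul_atTop_of_neg ?_)
      have : (0 : ℝ) < (n : ℝ) ^ 2 := by positivity
      nlinarith [Real.pi_pos]
  · filter_upwards [hτ.eventually_ge_atTop 1] with t ht n
    exact norm_jacobiTheta₂_term_le one_pos (by simp) ht n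

lemma jacobiTheta₂_zero_add_eq_sum {N : ℕ} [NeZero N] {α w : ℂ} (hα : α.im = 0) (hw : 0 < w.im)
    (hper : ∀ (m : ℤ) (a : Fin N), cexp (Real.pi * I * (m * N + (a : ℕ) : ℂ) ^ 2 * α) =
      cexp (Real.pi * I * ((a : ℕ) : ℂ) ^ 2 * α)) :
    jacobiTheta₂ 0 (α + w) = 1 / (-I * (N ^ 2 * w)) ^ (1 / 2 : ℂ) *
      ∑ a : Fin N, cexp (Real.pi * I * ((a : ℕ) : ℂ) ^ 2 * α) *
        jacobiTheta₂ (((a : ℕ) / N : ℝ) : ℂ) (-1 / (N ^ 2 * w)) := by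
  have hw0 : w ≠ 0 := by rintro rfl; simp at hw
  have hN0 : (N : ℂ) ≠ 0 := NeZero.ne _
  have hs := hasSum_jacobiTheta₂_term 0 (τ := α + w) (by simpa [hα] using hw)
  have hs' := ((Equiv.prodComm _ _).trans (Int.divModEquiv N).symm).hasSum_iff.mpr hs
  have hNw : 0 < ((N : ℂ) ^ 2 * w).im := by
    have : ((N : ℂ) ^ 2 * w).im = (N : ℝ) ^ 2 * w.im := by
      rw [show ((N : ℂ) ^ 2 * w) = (((N : ℝ) ^ 2 : ℝ) : ℂ) * w by push_cast; ring, im_ofReal_mul]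
    rw [this]
    have : (0 : ℝ) < N := Nat.cast_pos.mpr (NeZero.pos N)
    positivity
  have hfib : ∀ a : Fin N, HasSum (fun m : ℤ ↦ (fun n ↦ jacobiTheta₂_term n 0 (α + w))
      (((Equiv.prodComm _ _).trans (Int.divModEquiv N).symm) (a, m)))
      (1 / (-I * (N ^ 2 * w)) ^ (1 / 2 : ℂ) * (cexp (Real.pi * I * ((a : ℕ) : ℂ) ^ 2 * α) *
        jacobiTheta₂ (((a : ℕ) / N : ℝ) : ℂ) (-1 / (N ^ 2 * w)))) := by
    intro a
    have h1 := (hasSum_jacobiTheta₂_term ((a : ℕ) * N * w) hNw).mul_left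
      (cexp (Real.pi * I * ((a : ℕ) : ℂ) ^ 2 * α) * cexp (Real.pi * I * ((a : ℕ) : ℂ) ^ 2 * w))
    convert! h1 using 1
    · ext m
      simp only [Equiv.trans_apply, Equiv.prodComm_apply, Prod.swap_prod_mk,
        Int.divModEquiv_symm_apply, jacobiTheta₂_term]
      rw [← hper m a, ← Complex.exp_add, ← Complex.exp_add]
      push_cast
      ring_nf
    · rw [jacobiTheta₂_functional_equation ((a : ℕ) * N * w)]
      have e1 : (((a : ℕ) : ℂ) * N * w) / (N ^ 2 * w) = (((a : ℕ) / N : ℝ) : ℂ) := by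
        push_cast
        field_simp
      have e2 : -Real.pi * I * (((a : ℕ) : ℂ) * N * w) ^ 2 / (N ^ 2 * w) =
          -(Real.pi * I * ((a : ℕ) : ℂ) ^ 2 * w) := by
        field_simp
      rw [e1, e2, Complex.exp_neg]
      field_simp [Complex.exp_ne_zero]
  have h2 := hs'.prod_fiberwise hfib
  rw [Finset.mul_sum]
  exact h2.unique (hasSum_fintype _)

lemma ofReal_mul_cpow {r : ℝ} (hr : 0 < r) {z : ℂ} (hz : z ≠ 0) (s : ℂ) :
    ((r : ℂ) * z) ^ s = (r : ℂ) ^ s * z ^ s := by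
  have hr' : (r : ℂ) ≠ 0 := ofReal_ne_zero.mpr hr.ne'
  rw [cpow_def_of_ne_zero (mul_ne_zero hr' hz), cpow_def_of_ne_zero hr', cpow_def_of_ne_zero hz,
    log_ofReal_mul hr hz, ← Complex.exp_add, ofReal_log hr.le, add_mul]

lemma exp_odd_sq_mul_half (p : ℕ) (m : ℤ) :
    cexp (Real.pi * I * (m * 2 + 1 : ℂ) ^ 2 * (-(p : ℂ) / 2)) = (-I) ^ p := by
  obtain ⟨k, hk⟩ := Int.even_mul_succ_self m
  have hk' : (m : ℂ) * (m + 1) = k + k := by exact_mod_cast congrArg (Int.cast : ℤ → ℂ) hk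
  have : Real.pi * I * (m * 2 + 1 : ℂ) ^ 2 * (-(p : ℂ) / 2) =
      p * (-(Real.pi / 2 * I)) + ((-(2 * p * k) : ℤ) : ℂ) * (2 * Real.pi * I) := by
    push_cast
    linear_combination (-2 * Real.pi * I * p) * hk'
  rw [this, Complex.exp_add, Complex.exp_int_mul_two_pi_mul_I, mul_one, Complex.exp_nat_mul,
    Complex.exp_neg, Complex.exp_pi_div_two_mul_I, Complex.inv_I]

open Filter Topology in
lemma sum_exp_sq_eq (p : ℕ) [NeZero p] :
    ∑ a : Fin p, cexp (Real.pi * I * ((a : ℕ) : ℂ) ^ 2 * (2 / p)) =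
      (1 + (-I) ^ p) * Real.sqrt p / (1 - I) := by
  have hpC : (p : ℂ) ≠ 0 := NeZero.ne _
  have hpR : (0 : ℝ) < p := Nat.cast_pos.mpr (NeZero.pos p)
  let w : ℝ → ℂ := fun T ↦ I / T
  let τ : ℝ → ℂ := fun T ↦ 2 / p + w T
  let u : ℝ → ℂ := fun T ↦ p * w T / (2 * τ T)
  let A : ℝ → ℂ := fun T ↦ ∑ a : Fin p, cexp (Real.pi * I * ((a : ℕ) : ℂ) ^ 2 * (2 / p)) *
        jacobiTheta₂ (((a : ℕ) / p : ℝ) : ℂ) (-1 / (p ^ 2 * w T))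
  let B : ℝ → ℂ := fun T ↦ ∑ a : Fin 2, cexp (Real.pi * I * ((a : ℕ) : ℂ) ^ 2 * (-(p : ℂ) / 2)) *
        jacobiTheta₂ (((a : ℕ) / (2 : ℕ) : ℝ) : ℂ) (-1 / ((2 : ℕ) ^ 2 * u T))
  have hwim : ∀ T : ℝ, 0 < T → (w T).im = 1 / T := fun T hT ↦ by simp [w]
  have hτim : ∀ T : ℝ, 0 < T → (τ T).im = 1 / T := fun T hT ↦ by
    have : τ T = ((2 / p : ℝ) : ℂ) + w T := by simp [τ]
    rw [this, add_im, ofReal_im, zero_add, hwim T hT]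
  have hτ0 : ∀ T : ℝ, 0 < T → τ T ≠ 0 := fun T hT h ↦ by
    have := hτim T hT
    rw [h] at this
    simp [hT.ne] at this
  have hu1 : ∀ T : ℝ, 0 < T → -1 / τ T = -(p : ℂ) / 2 + u T := fun T hT ↦ by
    have := hτ0 T hT
    have e : w T = τ T - 2 / p := by simp [τ]
    simp only [u, e]
    field_simp
    ring
  have huinv : ∀ T : ℝ, 0 < T → -1 / ((2 : ℕ) ^ 2 * u T) =
      ((-1 / (2 * p) : ℝ) : ℂ) + ((T / p ^ 2 : ℝ) : ℂ) * I := fun T hT ↦ by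
    have h1 := hτ0 T hT
    have h2 : (T : ℂ) ≠ 0 := ofReal_ne_zero.mpr hT.ne'
    simp only [u]
    rw [show ((2 : ℕ) : ℂ) ^ 2 * (p * w T / (2 * τ T)) = 2 * p * w T / τ T by
      push_cast; field_simp]
    simp only [τ, w]
    push_cast
    field_simp
    ring_nf
    simp only [I_sq]
    ring
  have huim : ∀ T : ℝ, 0 < T → 0 < (u T).im := fun T hT ↦ by
    have : (u T).im = (-1 / τ T).im := by
      rw [hu1 T hT, add_im, show -(p : ℂ) / 2 = ((-p / 2 : ℝ) : ℂ) by push_cast; ring, ofReal_im,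
        zero_add]
    rw [this, div_im]
    simp only [neg_im, one_im, neg_re, one_re]
    rw [hτim T hT]
    have := normSq_pos.mpr (hτ0 T hT)
    have : 0 < 1 / T / normSq (τ T) := by positivity
    ring_nf at this ⊢
    exact this
  have hmain : ∀ T : ℝ, 0 < T → A T / p =
      B T / ((-I * τ T) ^ (1 / 2 : ℂ) * (2 * p / τ T) ^ (1 / 2 : ℂ)) := by
    intro T hT
    have h2 : (T : ℂ) ≠ 0 := ofReal_ne_zero.mpr hT.ne'
    have hTi : 0 < 1 / T := by positivity
    have hTi' : ((1 / T : ℝ) : ℂ) ^ (1 / 2 : ℂ) ≠ 0 := by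
      rw [Ne, cpow_eq_zero_iff]
      simp [hT.ne']
    have hl := jacobiTheta₂_zero_add_eq_sum (N := p) (α := 2 / p) (w := w T)
      (by simp) (by rw [hwim T hT]; exact hTi) (by
        intro m a
        rw [Complex.exp_eq_exp_iff_exists_int]
        refine ⟨m * (m * p + 2 * (a : ℕ)), ?_⟩
        push_cast
        field_simp
        ring)
    have hr := jacobiTheta₂_zero_add_eq_sum (N := 2) (α := -(p : ℂ) / 2) (w := u T)
      (by simp) (huim T hT) (by
        intro m a
        fin_cases a
        · simp only [Nat.cast_zero, Nat.cast_ofNat]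
          rw [Complex.exp_eq_exp_iff_exists_int]
          refine ⟨-(m ^ 2 * p), ?_⟩
          push_cast
          ring
        · have h1 := exp_odd_sq_mul_half p m
          have h0 := exp_odd_sq_mul_half p 0
          simp only [Nat.cast_one, Nat.cast_ofNat]
          rw [h1, ← h0]
          simp)
    have hfe := jacobiTheta₂_functional_equation 0 (τ T)
    have e1 : -I * ((p : ℂ) ^ 2 * w T) = ((1 / T : ℝ) : ℂ) * (p : ℂ) ^ 2 := by
      simp only [w]
      push_cast
      field_simp
      simp
    have e2 : -I * (((2 : ℕ) : ℂ) ^ 2 * u T) = ((1 / T : ℝ) : ℂ) * (2 * p / τ T) := by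
      have := hτ0 T hT
      simp only [u, w]
      push_cast
      field_simp
      ring_nf
      simp
    have e3 : ((p : ℂ) ^ 2) ^ (1 / 2 : ℂ) = p := by
      rw [one_div, sq_cpow_two_inv (by simpa using hpR)]
    rw [zero_div, hu1 T hT, hr, e2, ofReal_mul_cpow hTi (by simp [hpC, hτ0 T hT])] at hfe
    rw [e1, ofReal_mul_cpow hTi (by simp [hpC]), e3] at hl
    have := hl.symm.trans hfe
    simp only [ne_eq, OfNat.ofNat_ne_zero, not_false_eq_true, zero_pow, mul_zero, zero_div,
      Complex.exp_zero, mul_one] at this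
    change 1 / (_ * _) * A T = 1 / _ * (1 / (_ * _) * B T) at this
    have h3 : (-I * τ T) ^ (1 / 2 : ℂ) ≠ 0 := by
      rw [Ne, cpow_eq_zero_iff]
      simp [hτ0 T hT]
    have h4 : (2 * p / τ T) ^ (1 / 2 : ℂ) ≠ 0 := by
      rw [Ne, cpow_eq_zero_iff]
      simp [hτ0 T hT, hpC]
    generalize ((1 / T : ℝ) : ℂ) ^ (1 / 2 : ℂ) = x at *
    generalize (-I * τ T) ^ (1 / 2 : ℂ) = y at *
    generalize (2 * p / τ T) ^ (1 / 2 : ℂ) = z at *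
    field_simp at this ⊢
    exact this
  have hA : Tendsto A atTop
      (𝓝 (∑ a : Fin p, cexp (Real.pi * I * ((a : ℕ) : ℂ) ^ 2 * (2 / p)) * 1)) := by
    refine tendsto_finsetSum _ fun a _ ↦ Tendsto.const_mul _ (tendsto_jacobiTheta₂_one _ ?_)
    have : ∀ᶠ T : ℝ in atTop, T / p ^ 2 = (-1 / ((p : ℂ) ^ 2 * w T)).im := by
      filter_upwards [eventually_gt_atTop 0] with T hT
      have h2 : (T : ℂ) ≠ 0 := ofReal_ne_zero.mpr hT.ne'
      rw [show -1 / ((p : ℂ) ^ 2 * w T) = ((T / p ^ 2 : ℝ) : ℂ) * I by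
        simp only [w]; push_cast; field_simp; simp]
      rw [im_ofReal_mul, I_im, mul_one]
    exact (tendsto_id.atTop_div_const (by positivity)).congr' this
  have hB : Tendsto B atTop (𝓝 (∑ a : Fin 2,
      cexp (Real.pi * I * ((a : ℕ) : ℂ) ^ 2 * (-(p : ℂ) / 2)) * 1)) := by
    refine tendsto_finsetSum _ fun a _ ↦ Tendsto.const_mul _ (tendsto_jacobiTheta₂_one _ ?_)
    have : ∀ᶠ T : ℝ in atTop, T / p ^ 2 = (-1 / (((2 : ℕ) : ℂ) ^ 2 * u T)).im := by
      filter_upwards [eventually_gt_atTop 0] with T hT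
      rw [huinv T hT, add_im, ofReal_im, im_ofReal_mul, I_im, mul_one, zero_add]
    exact (tendsto_id.atTop_div_const (by positivity)).congr' this
  have hτl : Tendsto τ atTop (𝓝 (2 / p)) := by
    have : Tendsto w atTop (𝓝 0) := by
      rw [tendsto_zero_iff_norm_tendsto_zero]
      simpa [w] using (tendsto_inv_atTop_zero (𝕜 := ℝ)).abs
    simpa using this.const_add (2 / (p : ℂ))
  have e3 : ((p : ℂ) ^ 2) ^ (1 / 2 : ℂ) = p := by
    rw [one_div, sq_cpow_two_inv (by simpa using hpR)]
  have hs : (Real.sqrt p : ℂ) ^ 2 = p := by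
    rw [← ofReal_pow, Real.sq_sqrt hpR.le, ofReal_natCast]
  have hs0 : (Real.sqrt p : ℂ) ≠ 0 := ofReal_ne_zero.mpr (Real.sqrt_pos.mpr hpR).ne'
  have e4 : (-I * (2 / p)) ^ (1 / 2 : ℂ) = (1 - I) / Real.sqrt p := by
    have : -I * (2 / p) = ((1 - I) / Real.sqrt p) ^ 2 := by
      rw [div_pow, hs]
      ring_nf
      simp only [I_sq]
      ring
    rw [this, one_div, sq_cpow_two_inv]
    rw [div_ofReal_re]
    simpa using Real.sqrt_pos.mpr hpR
  have c1 : Tendsto (fun T ↦ (-I * τ T) ^ (1 / 2 : ℂ)) atTop (𝓝 ((1 - I) / Real.sqrt p)) := by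
    rw [← e4]
    refine (hτl.const_mul _).cpow tendsto_const_nhds (mem_slitPlane_iff.mpr (Or.inr ?_))
    have : (-I * (2 / p)).im = -(2 / p : ℝ) := by
      rw [show -I * (2 / p) = ((-(2 / p) : ℝ) : ℂ) * I by push_cast; ring, im_ofReal_mul, I_im,
        mul_one]
    rw [this]
    exact (neg_neg_of_pos (by positivity)).ne
  have c2 : Tendsto (fun T ↦ (2 * p / τ T) ^ (1 / 2 : ℂ)) atTop (𝓝 p) := by
    have hd : Tendsto (fun T ↦ 2 * p / τ T) atTop (𝓝 ((p : ℂ) ^ 2)) := by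
      have := (tendsto_const_nhds (x := 2 * (p : ℂ))).div hτl (by simp [hpC])
      have e : (p : ℂ) ^ 2 = 2 * p / (2 / p) := by field_simp
      rwa [e]
    have := hd.cpow (tendsto_const_nhds (x := (1 / 2 : ℂ)))
      (mem_slitPlane_iff.mpr (Or.inl (by
        rw [← ofReal_natCast, ← ofReal_pow, ofReal_re]; positivity)))
    rwa [e3] at this
  have h1I : (1 - I) ≠ 0 := fun h ↦ by simpa using congrArg re h
  have hR := hB.div (c1.mul c2) (by
    simp [h1I, hs0, hpC])
  have hlim := tendsto_nhds_unique ((hA.div_const (p : ℂ)).congr'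
    ((eventually_gt_atTop 0).mono hmain)) hR
  have h1 := exp_odd_sq_mul_half p 0
  simp only [Int.cast_zero, zero_mul, zero_add] at h1
  rw [Fin.sum_univ_two] at hlim
  simp only [Fin.val_zero, Fin.val_one, Nat.cast_one, h1, mul_one, Nat.cast_zero] at hlim
  simp only [ne_eq, OfNat.ofNat_ne_zero, not_false_eq_true, zero_pow, mul_zero, zero_mul,
      Complex.exp_zero] at hlim
  field_simp at hlim
  field_simp
  linear_combination hlim

lemma ZMod.natCast_fin_bijective (N : ℕ) [NeZero N] :
    Function.Bijective fun a : Fin N ↦ ((a : ℕ) : ZMod N) := by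
  rw [Fintype.bijective_iff_injective_and_card]
  refine ⟨fun a b hab ↦ Fin.ext ?_, by simp⟩
  simpa [ZMod.natCast_eq_natCast_iff', Nat.mod_eq_of_lt a.2, Nat.mod_eq_of_lt b.2] using hab

lemma sum_stdAddChar_mul (N : ℕ) [NeZero N] (b : ZMod N) :
    ∑ x : ZMod N, ZMod.stdAddChar (b * x) = if b = 0 then (N : ℂ) else 0 := by
  have := AddChar.sum_mulShift b (ZMod.isPrimitive_stdAddChar N)
  simp only [ZMod.card, mul_comm _ b] at this
  rw [this]
  push_cast
  rfl

lemma one_add_neg_I_pow {p : ℕ} (hp : Odd p) : 1 + (-I) ^ p = cP p * (1 - I) := by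
  have hp4 : p % 4 = 1 ∨ p % 4 = 3 := by
    obtain ⟨k, rfl⟩ := hp
    omega
  have hI : (-I) ^ 4 = 1 := by rw [Even.neg_pow (by decide), I_pow_four]
  rw [← Nat.div_add_mod p 4, pow_add, pow_mul, hI, one_pow, one_mul, Nat.div_add_mod, cP]
  rcases hp4 with h | h
  · simp [h, sub_eq_add_neg]
  · have : (-I) ^ 3 = I := by rw [Odd.neg_pow (by decide), I_pow_three, neg_neg]
    simp [h, this, mul_sub, add_comm]

lemma sum_quadraticChar_mul_stdAddChar (p : ℕ) [Fact p.Prime] (hp : Odd p) :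
    ∑ y : ZMod p, (quadraticChar (ZMod p) y : ℂ) * ZMod.stdAddChar y = cP p * Real.sqrt p := by
  have hp2 : ringChar (ZMod p) ≠ 2 := by
    rw [ZMod.ringChar_zmod_n]
    rintro rfl
    exact absurd hp (by decide)
  have h0 : ∑ y : ZMod p, (ZMod.stdAddChar y : ℂ) = 0 := by
    simpa using sum_stdAddChar_mul p 1
  have hsq : ∑ x : ZMod p, (ZMod.stdAddChar (x ^ 2) : ℂ) = cP p * Real.sqrt p := by
    rw [← (ZMod.natCast_fin_bijective p).sum_comp fun x ↦ (ZMod.stdAddChar (x ^ 2) : ℂ)]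
    have h1I : (1 - I) ≠ 0 := fun h ↦ by simpa using congrArg re h
    trans (1 + (-I) ^ p) * Real.sqrt p / (1 - I)
    · rw [← sum_exp_sq_eq]
      refine Finset.sum_congr rfl fun a _ ↦ ?_
      have := ZMod.stdAddChar_coe (N := p) ((a : ℕ) ^ 2 : ℤ)
      push_cast at this
      rw [this]
      ring_nf
    · rw [one_add_neg_I_pow hp]
      field_simp
  rw [← hsq, ← add_zero (∑ y : ZMod p, _), ← h0, ← Finset.sum_add_distrib,
    ← Finset.sum_fiberwise Finset.univ (fun x : ZMod p ↦ x ^ 2)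
      fun x ↦ (ZMod.stdAddChar (x ^ 2) : ℂ)]
  refine Finset.sum_congr rfl fun y _ ↦ ?_
  rw [Finset.sum_congr rfl (g := fun _ ↦ (ZMod.stdAddChar y : ℂ))
    fun x hx ↦ by rw [(Finset.mem_filter.mp hx).2], Finset.sum_const, nsmul_eq_mul]
  have hc := quadraticChar_card_sqrts hp2 y
  have : ({x : ZMod p | x ^ 2 = y} : Set (ZMod p)).toFinset =
      Finset.univ.filter fun x : ZMod p ↦ x ^ 2 = y := by ext; simp
  rw [this] at hc
  have hc' : ((Finset.univ.filter fun x : ZMod p ↦ x ^ 2 = y).card : ℂ) =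
      quadraticChar (ZMod p) y + 1 := by exact_mod_cast congrArg (Int.cast : ℤ → ℂ) hc
  rw [hc']
  ring

lemma sum_quadraticChar_mul_stdAddChar_mul (p : ℕ) [Fact p.Prime] (hp : Odd p) (b : ZMod p) :
    ∑ y : ZMod p, (quadraticChar (ZMod p) y : ℂ) * ZMod.stdAddChar (b * y) =
      quadraticChar (ZMod p) b * (cP p * Real.sqrt p) := by
  have hp2 : ringChar (ZMod p) ≠ 2 := by
    rw [ZMod.ringChar_zmod_n]
    rintro rfl
    exact absurd hp (by decide)
  by_cases hb : b = 0
  · have := quadraticChar_sum_zero hp2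
    simp only [hb, zero_mul, AddChar.map_zero_eq_one, mul_one, MulChar.map_zero, Int.cast_zero]
    exact_mod_cast this
  · rw [← sum_quadraticChar_mul_stdAddChar p hp,
      ← (mulLeft_bijective₀ b hb).sum_comp fun y ↦
        (quadraticChar (ZMod p) y : ℂ) * ZMod.stdAddChar y, Finset.mul_sum]
    refine Finset.sum_congr rfl fun y _ ↦ ?_
    have h1 : (quadraticChar (ZMod p) b : ℂ) ^ 2 = 1 := by
      exact_mod_cast quadraticChar_sq_one hb
    rw [map_mul (quadraticChar (ZMod p))]
    push_cast
    linear_combination (-(quadraticChar (ZMod p) y : ℂ) * ZMod.stdAddChar (b * y)) * h1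

lemma aChar_eq_stdAddChar (N : ℕ) [NeZero N] (r : ℤ) (x : ZMod N) :
    aChar N r x = ZMod.stdAddChar ((r : ZMod N) * x) := by
  have := ZMod.stdAddChar_coe (N := N) (r * (x.val : ℤ))
  push_cast at this
  rw [ZMod.natCast_zmod_val] at this
  rw [this, aChar]
  ring_nf

lemma sum_units_mul_aChar (p k : ℕ) [Fact p.Prime] {r : ℤ} (hr : ¬ (p : ℤ) ∣ r) (s : ℤ)
    (F : ZMod p → ℂ) :
    ∑ d : (ZMod (p ^ (k + 1)))ˣ, F ((d : ZMod (p ^ (k + 1))).val : ZMod p) *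
        aChar (p ^ (k + 1)) r ((s : ZMod (p ^ (k + 1))) * d) =
      if (p : ℤ) ^ k ∣ s then (p : ℂ) ^ k * ∑ y : ZMod p, (if y = 0 then 0 else F y) *
        ZMod.stdAddChar (((r * (s / (p : ℤ) ^ k) : ℤ) : ZMod p) * y) else 0 := by
  have hpp : p.Prime := Fact.out
  have hpC : (p : ℂ) ≠ 0 := Nat.cast_ne_zero.mpr hpp.ne_zero
  set G : ZMod p → ℂ := fun y ↦ if y = 0 then 0 else F y with hG
  have hunit : ∀ x : ZMod (p ^ (k + 1)), IsUnit x ↔ (x.val : ZMod p) ≠ 0 := fun x ↦ by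
    conv_lhs => rw [← ZMod.natCast_zmod_val x]
    rw [ZMod.isUnit_iff_coprime, Nat.coprime_pow_right_iff k.succ_pos, Nat.coprime_comm,
      hpp.coprime_iff_not_dvd, Ne, ZMod.natCast_eq_zero_iff]
  rw [Fintype.sum_of_injective (Units.val : (ZMod (p ^ (k + 1)))ˣ → _) Units.val_injective _
    (fun x ↦ G (x.val : ZMod p) * aChar (p ^ (k + 1)) r ((s : ZMod (p ^ (k + 1))) * x))
    (fun x hx ↦ by
      have : (x.val : ZMod p) = 0 := by
        by_contra h
        obtain ⟨d, hd⟩ := (hunit x).mpr h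
        exact hx ⟨d, hd⟩
      simp [hG, this])
    (fun d ↦ by simp only [hG, if_neg ((hunit _).mp d.isUnit)]),
    ← (ZMod.natCast_fin_bijective _).sum_comp,
    ← (finCongr (pow_succ p k).symm).sum_comp, ← finProdFinEquiv.sum_comp,
    Fintype.sum_prod_type_right]
  have hterm : ∀ (z : Fin (p ^ k)) (y : Fin p),
      aChar (p ^ (k + 1)) r (s * ((((y : ℕ) + p * (z : ℕ) : ℕ)) : ZMod (p ^ (k + 1)))) =
      cexp (2 * Real.pi * I * (r * s * (y : ℕ)) / p ^ (k + 1)) *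
        ZMod.stdAddChar ((((r * s : ℤ)) : ZMod (p ^ k)) * ((z : ℕ) : ZMod (p ^ k))) := by
    intro z y
    have h1 := ZMod.stdAddChar_coe (N := p ^ (k + 1)) (r * (s * ((y : ℕ) + p * (z : ℕ))))
    have h2 := ZMod.stdAddChar_coe (N := p ^ k) (r * s * (z : ℕ))
    push_cast at h1 h2 ⊢
    rw [aChar_eq_stdAddChar, h1, h2, ← Complex.exp_add]
    congr 1
    field_simp
    ring
  have hval : ∀ (z : Fin (p ^ k)) (y : Fin p),
      ((((((y : ℕ) + p * (z : ℕ) : ℕ)) : ZMod (p ^ (k + 1))).val : ℕ) : ZMod p) = (y : ℕ) := by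
    intro z y
    rw [ZMod.val_natCast, ← ZMod.natCast_mod, Nat.mod_mod_of_dvd _ (dvd_pow_self p k.succ_ne_zero),
      ZMod.natCast_mod]
    simp
  simp only [finCongr_apply, Fin.val_cast, finProdFinEquiv_apply_val, hval, hterm,
    ← Finset.mul_sum]
  rw [(ZMod.natCast_fin_bijective (p ^ k)).sum_comp fun z ↦
    (ZMod.stdAddChar (((r * s : ℤ) : ZMod (p ^ k)) * z) : ℂ), sum_stdAddChar_mul]
  have hdvd : ((r * s : ℤ) : ZMod (p ^ k)) = 0 ↔ (p : ℤ) ^ k ∣ s := by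
    rw [ZMod.intCast_zmod_eq_zero_iff_dvd]
    push_cast
    have hcop : IsCoprime ((p : ℤ) ^ k) r :=
      ((Nat.prime_iff_prime_int.mp hpp).coprime_iff_not_dvd.mpr hr).pow_left
    exact ⟨hcop.dvd_of_dvd_mul_left, fun h ↦ h.mul_left r⟩
  simp only [hdvd]
  split_ifs with hs
  · obtain ⟨c, rfl⟩ := hs
    rw [Int.mul_ediv_cancel_left _ (pow_ne_zero _ (Nat.cast_ne_zero.mpr hpp.ne_zero)),
      Finset.mul_sum, ← (ZMod.natCast_fin_bijective p).sum_comp]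
    refine Finset.sum_congr rfl fun y _ ↦ ?_
    have h1 := ZMod.stdAddChar_coe (N := p) (r * c * (y : ℕ))
    push_cast at h1 ⊢
    rw [h1]
    have : 2 * Real.pi * I * (r * ((p : ℂ) ^ k * c) * (y : ℕ)) / (p : ℂ) ^ (k + 1) =
      2 * Real.pi * I * (r * c * (y : ℕ)) / p := by
      field_simp
      ring
    rw [this]
    ring
  · simp

lemma sum_units_legC_even (p k j : ℕ) [Fact p.Prime] (hj : Even j) {r : ℤ}
    (hr : ¬ (p : ℤ) ∣ r) (c₁ : ℤ) :
    ∑ d : (ZMod (p ^ (k + 1)))ˣ, legC p (d : ZMod (p ^ (k + 1))) ^ j *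
        aChar (p ^ (k + 1)) r ((((p : ℤ) ^ k * c₁ : ℤ) : ZMod (p ^ (k + 1))) * d) =
      (p : ℂ) ^ k * ((if (p : ℤ) ∣ c₁ then (p : ℂ) else 0) - 1) := by
  have hpp : p.Prime := Fact.out
  have h := sum_units_mul_aChar p k hr ((p : ℤ) ^ k * c₁)
    fun y ↦ (quadraticChar (ZMod p) y : ℂ) ^ j
  rw [if_pos (dvd_mul_right _ _),
    Int.mul_ediv_cancel_left _ (pow_ne_zero _ (Nat.cast_ne_zero.mpr hpp.ne_zero))] at h
  simp only [legC, legendreSym, Int.cast_natCast]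
  rw [h]
  have hy : ∀ y : ZMod p, (if y = 0 then 0 else (quadraticChar (ZMod p) y : ℂ) ^ j) *
      ZMod.stdAddChar (((r * c₁ : ℤ) : ZMod p) * y) =
      ZMod.stdAddChar (((r * c₁ : ℤ) : ZMod p) * y) - if y = 0 then 1 else 0 := by
    intro y
    split_ifs with hy
    · simp [hy]
    · obtain ⟨m, rfl⟩ := hj
      have : (quadraticChar (ZMod p) y : ℂ) ^ 2 = 1 := by exact_mod_cast quadraticChar_sq_one hy
      rw [← two_mul, pow_mul, this]
      simp
  simp only [hy, Finset.sum_sub_distrib, sum_stdAddChar_mul, Finset.sum_ite_eq',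
    Finset.mem_univ, if_true, ZMod.intCast_zmod_eq_zero_iff_dvd,
    (Nat.prime_iff_prime_int.mp hpp).dvd_mul, hr, false_or]

lemma sum_units_legC_odd (p k j : ℕ) [Fact p.Prime] (hp : Odd p) (hj : Odd j) {r : ℤ}
    (hr : ¬ (p : ℤ) ∣ r) (c₁ : ℤ) :
    ∑ d : (ZMod (p ^ (k + 1)))ˣ, legC p (d : ZMod (p ^ (k + 1))) ^ j *
        aChar (p ^ (k + 1)) r ((((p : ℤ) ^ k * c₁ : ℤ) : ZMod (p ^ (k + 1))) * d) =
      (legendreSym p (c₁ * r) : ℂ) * cP p * (p : ℂ) ^ k * Real.sqrt p := by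
  have hpp : p.Prime := Fact.out
  have h := sum_units_mul_aChar p k hr ((p : ℤ) ^ k * c₁)
    fun y ↦ (quadraticChar (ZMod p) y : ℂ) ^ j
  rw [if_pos (dvd_mul_right _ _),
    Int.mul_ediv_cancel_left _ (pow_ne_zero _ (Nat.cast_ne_zero.mpr hpp.ne_zero))] at h
  simp only [legC, legendreSym, Int.cast_natCast]
  rw [h]
  have hy : ∀ y : ZMod p, (if y = 0 then 0 else (quadraticChar (ZMod p) y : ℂ) ^ j) =
      quadraticChar (ZMod p) y := by
    intro y
    split_ifs with hy
    · simp [hy]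
    · obtain ⟨m, rfl⟩ := hj
      have : (quadraticChar (ZMod p) y : ℂ) ^ 2 = 1 := by exact_mod_cast quadraticChar_sq_one hy
      rw [pow_succ, pow_mul, this, one_pow, one_mul]
  simp only [hy, sum_quadraticChar_mul_stdAddChar_mul p hp, mul_comm r c₁]
  ring

/-- §4, case (v): evaluation of the twisted sum
`g(c) = Σ_{d ∈ (ℤ/p^h)^×} (d/p)^j · λ₁((4−c²)d)`. It equals `p^{h−1}(p−1)` if `j` is
even and `p^h ∣ 4−c²`; `−p^{h−1}` if `j` is even and `4−c² = p^{h−1}c₁` with `p ∤ c₁`;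
`(c₁r/p)·c_p·p^{h−1}·√p` if `j` is odd and `4−c² = p^{h−1}c₁` with `p ∤ c₁`; and `0`
in all other cases. -/
theorem appendix_g_eval (p h j : ℕ) [Fact p.Prime] (hp : Odd p) (hh : 1 ≤ h)
    (r : ℤ) (hpr : ¬ ((p : ℤ) ∣ r)) (c : ℤ) :
    (Even j → (p : ℤ) ^ h ∣ (4 - c ^ 2) →
      (∑ d : (ZMod (p ^ h))ˣ, legC p (d : ZMod (p ^ h)) ^ j *
          aChar (p ^ h) r (((4 - c ^ 2 : ℤ) : ZMod (p ^ h)) * (d : ZMod (p ^ h))))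
        = (p : ℂ) ^ (h - 1) * ((p : ℂ) - 1)) ∧
    (Even j → ∀ c₁ : ℤ, 4 - c ^ 2 = (p : ℤ) ^ (h - 1) * c₁ → ¬ ((p : ℤ) ∣ c₁) →
      (∑ d : (ZMod (p ^ h))ˣ, legC p (d : ZMod (p ^ h)) ^ j *
          aChar (p ^ h) r (((4 - c ^ 2 : ℤ) : ZMod (p ^ h)) * (d : ZMod (p ^ h))))
        = -(p : ℂ) ^ (h - 1)) ∧
    (Odd j → ∀ c₁ : ℤ, 4 - c ^ 2 = (p : ℤ) ^ (h - 1) * c₁ → ¬ ((p : ℤ) ∣ c₁) →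
      (∑ d : (ZMod (p ^ h))ˣ, legC p (d : ZMod (p ^ h)) ^ j *
          aChar (p ^ h) r (((4 - c ^ 2 : ℤ) : ZMod (p ^ h)) * (d : ZMod (p ^ h))))
        = (legendreSym p (c₁ * r) : ℂ) * cP p * (p : ℂ) ^ (h - 1) * (Real.sqrt p : ℂ)) ∧
    (¬ (Even j ∧ (p : ℤ) ^ h ∣ (4 - c ^ 2)) →
      ¬ (∃ c₁ : ℤ, 4 - c ^ 2 = (p : ℤ) ^ (h - 1) * c₁ ∧ ¬ ((p : ℤ) ∣ c₁)) →
      (∑ d : (ZMod (p ^ h))ˣ, legC p (d : ZMod (p ^ h)) ^ j *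
          aChar (p ^ h) r (((4 - c ^ 2 : ℤ) : ZMod (p ^ h)) * (d : ZMod (p ^ h))))
        = 0) := by
  obtain ⟨k, rfl⟩ : ∃ k, h = k + 1 := ⟨h - 1, by omega⟩
  simp only [Nat.add_sub_cancel]
  generalize 4 - c ^ 2 = s
  refine ⟨?_, ?_, ?_, ?_⟩
  · rintro hj ⟨m, rfl⟩
    rw [pow_succ (p : ℤ), mul_assoc, sum_units_legC_even p k j hj hpr,
      if_pos (dvd_mul_right _ _)]
  · rintro hj c₁ rfl hc₁
    rw [sum_units_legC_even p k j hj hpr, if_neg hc₁]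
    ring
  · rintro hj c₁ rfl -
    exact sum_units_legC_odd p k j hp hj hpr c₁
  · intro h1 h2
    by_cases hs : (p : ℤ) ^ k ∣ s
    · obtain ⟨c₁, rfl⟩ := hs
      have hc₁ : (p : ℤ) ∣ c₁ := by
        by_contra hc
        exact h2 ⟨c₁, rfl, hc⟩
      have hj : Odd j := by
        rw [← Nat.not_even_iff_odd]
        exact fun hj ↦ h1 ⟨hj, by rw [pow_succ]; exact mul_dvd_mul_left _ hc₁⟩
      have hl : legendreSym p (c₁ * r) = 0 := by
        rw [legendreSym.eq_zero_iff, ZMod.intCast_zmod_eq_zero_iff_dvd]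
        exact hc₁.mul_right r
      rw [sum_units_legC_odd p k j hp hj hpr, hl]
      simp
    · have h := sum_units_mul_aChar p k hpr s fun y ↦ (quadraticChar (ZMod p) y : ℂ) ^ j
      rw [if_neg hs] at h
      simpa only [legC, legendreSym, Int.cast_natCast] using h
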